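/- arXiv:1602.06339 — 8 statements merged into one kernel-verified Lean document; each statement's English description precedes it below -/
import Mathlib

section
/- Let m, n ≥ 1 and let θ be a monoid congruence on T_m × T_n such that both projections of θ are non-trivial: there exist p, q ∈ T_m × T_n with θ p q and p.1 ≠ q.1, and there exist p', q' ∈ T_m × T_n with θ p' q' and p'.2 ≠ q'.2. Then there exists z ∈ T_m × T_n whose θ-class is a two-sided ideal of T_m × T_n. -/
/-- If both projections of a congruence `θ` on `T_m × T_n` (`m, n ≥ 1`)
are non-trivial, then `θ` has a class which is a two-sided ideal. -/
theorem stmt_5 {m n : ℕ} (hm : 1 ≤ m) (hn : 1 ≤ n)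
    (θ : Con (Function.End (Fin m) × Function.End (Fin n)))
    (h1 : ∃ p q : Function.End (Fin m) × Function.End (Fin n), θ p q ∧ p.1 ≠ q.1)
    (h2 : ∃ p q : Function.End (Fin m) × Function.End (Fin n), θ p q ∧ p.2 ≠ q.2) :
    ∃ z : Function.End (Fin m) × Function.End (Fin n),
      ∀ p, θ p z → ∀ x y : Function.End (Fin m) × Function.End (Fin n), θ (x * p * y) z := by
  obtain ⟨p, q, hpq, hne⟩ := h1
  obtain ⟨p', q', hpq', hne'⟩ := h2
  obtain ⟨i, hi⟩ := Function.ne_iff.mp hne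
  obtain ⟨j, hj⟩ := Function.ne_iff.mp hne'
  let i0 : Fin m := ⟨0, hm⟩
  let j0 : Fin n := ⟨0, hn⟩
  let c : Fin m → Fin n → Function.End (Fin m) × Function.End (Fin n) :=
    fun a b => (fun _ => a, fun _ => b)
  have H1 : ∀ a a' b, θ (c a b) (c a' b) := by
    intro a a' b
    have h := θ.mul (θ.mul
      (θ.refl ((fun t => if t = p.1 i then a else a', fun _ => b) :
        Function.End (Fin m) × Function.End (Fin n))) hpq) (θ.refl (c i j0))
    change θ (c (if p.1 i = p.1 i then a else a') b) (c (if q.1 i = p.1 i then a else a') b) at h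
    rwa [if_pos rfl, if_neg (Ne.symm hi)] at h
  have H2 : ∀ a b b', θ (c a b) (c a b') := by
    intro a b b'
    have h := θ.mul (θ.mul
      (θ.refl ((fun _ => a, fun t => if t = p'.2 j then b else b') :
        Function.End (Fin m) × Function.End (Fin n))) hpq') (θ.refl (c i0 j))
    change θ (c a (if p'.2 j = p'.2 j then b else b')) (c a (if q'.2 j = p'.2 j then b else b')) at h
    rwa [if_pos rfl, if_neg (Ne.symm hj)] at h
  refine ⟨c i0 j0, fun r hr x y => ?_⟩
  have h := θ.mul (θ.mul (θ.refl x) hr) (θ.refl y)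
  have e : x * c i0 j0 * y = c (x.1 i0) (x.2 j0) := rfl
  rw [e] at h
  exact θ.trans h (θ.trans (H1 _ i0 _) (H2 _ _ _))
end

section
/- Let i and k be natural numbers and let N be a subgroup of the product group Perm(Fin i) × Perm(Fin k) of permutation groups. Then N is a normal subgroup if and only if either (a) there exist normal subgroups N₁ of Perm(Fin i) and N₂ of Perm(Fin k) such that N = N₁ × N₂ (the product subgroup), or (b) N = {(a, b) : Perm(Fin i) × Perm(Fin k) | sign a = sign b}, the subgroup of all pairs of permutations with the same signature. -/
open Equiv Equiv.Perm in
/-- A normal subgroup containing a three-cycle contains all even permutations. -/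
theorem aux_three {n : ℕ} (N : Subgroup (Equiv.Perm (Fin n))) (hN : N.Normal)
    (t : Equiv.Perm (Fin n)) (ht : t.IsThreeCycle) (htN : t ∈ N) :
    alternatingGroup (Fin n) ≤ N := by
  rw [← closure_three_cycles_eq_alternating, Subgroup.closure_le]
  intro s hs
  have hc : IsConj t s := by
    rw [Equiv.Perm.isConj_iff_cycleType_eq]
    exact ht.trans (Eq.symm hs)
  obtain ⟨c, rfl⟩ := isConj_iff.1 hc
  exact hN.conj_mem _ htN _

open Equiv Equiv.Perm in
/-- An element that is central modulo a normal subgroup `N` is in `N`, unless `N` contains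
all even permutations. -/
theorem aux_central {n : ℕ} (N : Subgroup (Equiv.Perm (Fin n))) (hN : N.Normal)
    (z : Equiv.Perm (Fin n)) (hz : ∀ g, z * g * z⁻¹ * g⁻¹ ∈ N) (hzN : z ∉ N) :
    alternatingGroup (Fin n) ≤ N := by
  have hsw : ∀ x y, swap (z x) (z y) * swap x y ∈ N := by
    intro x y
    have h := hz (swap x y)
    rwa [Equiv.swap_apply_apply, ← Equiv.swap_inv x y] at *
  have hz1 : ∃ a, z a ≠ a := by
    by_contra! h
    exact hzN ((Equiv.ext h : z = 1) ▸ N.one_mem)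
  obtain ⟨a, ha⟩ := hz1
  by_cases h2 : ∀ c, c = a ∨ c = z a
  · intro s hs
    have h1 : s = 1 ∨ s = z := by
      by_cases hsa : s a = a
      · left
        ext c
        rcases h2 c with rfl | rfl
        · simp [hsa]
        · rcases h2 (s (z a)) with h | h
          · exact absurd (s.injective (h.trans hsa.symm)) ha
          · simp [h]
      · right
        have hsa' : s a = z a := (h2 _).resolve_left hsa
        ext c
        rcases h2 c with rfl | rfl
        · simp [hsa']
        · rcases h2 (s (z a)) with h | h
          · rcases h2 (z (z a)) with h' | h'
            · simp [h, h']
            · exact absurd (z.injective h') ha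
          · exact absurd (s.injective (h.trans hsa'.symm)) ha
    rcases h1 with rfl | rfl
    · exact N.one_mem
    · exfalso
      have : s = swap a (s a) := by
        ext c
        rcases h2 c with h | h
        · rw [h]; simp
        · rw [h, swap_apply_right]
          rcases h2 (s (s a)) with h' | h'
          · rw [h']
          · exact absurd (s.injective h') ha
      rw [mem_alternatingGroup, this, sign_swap (Ne.symm ha)] at hs
      exact absurd hs (by decide)
  push Not at h2
  obtain ⟨c, hca, hcb⟩ := h2
  by_contra hA
  have key : ∀ t : Perm (Fin n), t.IsThreeCycle → t ∉ N := fun t ht h =>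
    hA (aux_three N hN t ht h)
  -- no fixed points
  have hfix : ∀ e, z e ≠ e := by
    intro e he
    have hea : e ≠ a := by rintro rfl; exact ha he
    have heb : e ≠ z a := by
      intro h
      rw [h] at he
      exact ha (z.injective he)
    have h := hsw e a
    rw [he] at h
    exact key _ (isThreeCycle_swap_mul_swap_same heb hea (ha)) h
  have hinv : ∀ e, z (z e) = e := by
    intro e
    by_contra hne
    have h := hsw (z e) e
    rw [swap_comm (z (z e))] at h
    exact key _ (isThreeCycle_swap_mul_swap_same (z.injective.ne (hfix e).symm) (hfix e) hne) h
  have hda : z c ≠ a := fun h => hcb (by rw [← h, hinv])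
  have hdb : z c ≠ z a := z.injective.ne hca
  have hdc := hfix c
  have hy := hsw a c
  by_cases h4 : ∃ e, e ≠ a ∧ e ≠ z a ∧ e ≠ c ∧ e ≠ z c
  · obtain ⟨e, he1, he2, he3, he4⟩ := h4
    have h5 := hN.conj_mem _ hy (swap c e)
    have h6 := N.mul_mem (N.inv_mem hy) h5
    have h7 : (swap (z a) (z c) * swap a c)⁻¹ *
        (swap c e * (swap (z a) (z c) * swap a c) * (swap c e)⁻¹) = swap a c * swap a e := by
      have e1 : swap c e * (swap (z a) (z c) * swap a c) * (swap c e)⁻¹ =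
          (swap c e * swap (z a) (z c) * (swap c e)⁻¹) * (swap c e * swap a c * (swap c e)⁻¹) := by
        group
      rw [e1, ← Equiv.swap_apply_apply, ← Equiv.swap_apply_apply,
        swap_apply_of_ne_of_ne hcb.symm he2.symm, swap_apply_of_ne_of_ne hdc he4.symm,
        swap_apply_of_ne_of_ne hca.symm he1.symm, swap_apply_left]
      simp [mul_assoc]
    rw [h7] at h6
    exact key _ (isThreeCycle_swap_mul_swap_same hca.symm he1.symm he3.symm) h6
  · push Not at h4
    have h5 := hN.conj_mem _ hy (swap (z a) c)
    have e1 : swap (z a) c * (swap (z a) (z c) * swap a c) * (swap (z a) c)⁻¹ =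
        (swap (z a) c * swap (z a) (z c) * (swap (z a) c)⁻¹) *
          (swap (z a) c * swap a c * (swap (z a) c)⁻¹) := by
      group
    rw [e1, ← Equiv.swap_apply_apply, ← Equiv.swap_apply_apply, swap_apply_left,
      swap_apply_right, swap_apply_of_ne_of_ne hdb hdc,
      swap_apply_of_ne_of_ne ha.symm hca.symm] at h5
    apply hzN
    convert h5 using 1
    refine Equiv.ext fun e => ?_
    rw [Perm.mul_apply]
    by_cases q1 : e = a
    · rw [q1, swap_apply_left, swap_apply_of_ne_of_ne hcb.symm hdb.symm]
    by_cases q2 : e = z a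
    · rw [q2, swap_apply_right, swap_apply_of_ne_of_ne hca.symm hda.symm, hinv]
    by_cases q3 : e = c
    · rw [q3, swap_apply_of_ne_of_ne hca hcb, swap_apply_left]
    have q4 := h4 e q1 q2 q3
    rw [q4, swap_apply_of_ne_of_ne hda hdb, swap_apply_right, hinv]

open Equiv Equiv.Perm in
theorem aux_main (i k : ℕ) (N : Subgroup (Equiv.Perm (Fin i) × Equiv.Perm (Fin k)))
    (hN : N.Normal) :
      ((∃ (N₁ : Subgroup (Equiv.Perm (Fin i))) (N₂ : Subgroup (Equiv.Perm (Fin k))),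
          N₁.Normal ∧ N₂.Normal ∧ N = N₁.prod N₂) ∨
        (∀ p : Equiv.Perm (Fin i) × Equiv.Perm (Fin k),
          p ∈ N ↔ Equiv.Perm.sign p.1 = Equiv.Perm.sign p.2)) := by
  have hA : (N.comap (MonoidHom.inl (Perm (Fin i)) (Perm (Fin k)))).Normal := hN.comap _
  have hB : (N.comap (MonoidHom.inr (Perm (Fin i)) (Perm (Fin k)))).Normal := hN.comap _
  set A := N.comap (MonoidHom.inl (Perm (Fin i)) (Perm (Fin k))) with hAd
  set B := N.comap (MonoidHom.inr (Perm (Fin i)) (Perm (Fin k))) with hBd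
  have mA : ∀ x, x ∈ A ↔ (x, 1) ∈ N := fun x => Iff.rfl
  have mB : ∀ x, x ∈ B ↔ (1, x) ∈ N := fun x => Iff.rfl
  have mAB : ∀ x y, x ∈ A → y ∈ B → (x, y) ∈ N := by
    intro x y hx hy
    have := N.mul_mem ((mA x).1 hx) ((mB y).1 hy)
    simpa using this
  have hBA : ∀ x y, (x, y) ∈ N → y ∈ B → x ∈ A := by
    intro x y h hy
    have := N.mul_mem h (N.inv_mem ((mB y).1 hy))
    rw [mA]
    simpa using this
  have hAB : ∀ x y, (x, y) ∈ N → x ∈ A → y ∈ B := by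
    intro x y h hx
    have := N.mul_mem (N.inv_mem ((mA x).1 hx)) h
    rw [mB]
    simpa using this
  by_cases hall : ∀ x y, (x, y) ∈ N → x ∈ A
  · left
    refine ⟨A, B, hA, hB, ?_⟩
    ext ⟨x, y⟩
    rw [Subgroup.mem_prod]
    exact ⟨fun h => ⟨hall x y h, hAB x y h (hall x y h)⟩, fun h => mAB x y h.1 h.2⟩
  right
  push Not at hall
  obtain ⟨a, b, hab, ha⟩ := hall
  have hb : b ∉ B := fun h => ha (hBA a b hab h)
  have cA : alternatingGroup (Fin i) ≤ A := by
    refine aux_central A hA a (fun g => ?_) ha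
    have h := N.mul_mem hab (hN.conj_mem _ (N.inv_mem hab) (g, 1))
    rw [mA]
    simpa [mul_assoc] using h
  have cB : alternatingGroup (Fin k) ≤ B := by
    refine aux_central B hB b (fun g => ?_) hb
    have h := N.mul_mem hab (hN.conj_mem _ (N.inv_mem hab) (1, g))
    rw [mB]
    simpa [mul_assoc] using h
  have eA : ∀ x, sign x = 1 → x ∈ A := fun x hx => cA (mem_alternatingGroup.2 hx)
  have eB : ∀ x, sign x = 1 → x ∈ B := fun x hx => cB (mem_alternatingGroup.2 hx)
  have sa : sign a = -1 := (Int.units_eq_one_or _).resolve_left fun h => ha (eA a h)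
  have sb : sign b = -1 := (Int.units_eq_one_or _).resolve_left fun h => hb (eB b h)
  have oA : ∀ x, x ∈ A → sign x = 1 := by
    intro x hx
    refine (Int.units_eq_one_or _).resolve_right fun h => ha ?_
    have := A.mul_mem (eA (a * x⁻¹) (by simp [sa, h])) hx
    simpa using this
  have oB : ∀ x, x ∈ B → sign x = 1 := by
    intro x hx
    refine (Int.units_eq_one_or _).resolve_right fun h => hb ?_
    have := B.mul_mem (eB (b * x⁻¹) (by simp [sb, h])) hx
    simpa using this
  rintro ⟨x, y⟩
  constructor
  · intro h
    show sign x = sign y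
    rcases Int.units_eq_one_or (sign x) with hx | hx
    · rw [hx, oB y (hAB x y h (eA x hx))]
    · rcases Int.units_eq_one_or (sign y) with hy | hy
      · rw [hy, oA x (hBA x y h (eB y hy))]
      · rw [hx, hy]
  · intro h
    change sign x = sign y at h
    rcases Int.units_eq_one_or (sign x) with hx | hx
    · exact mAB x y (eA x hx) (eB y (h ▸ hx))
    · have := N.mul_mem (mAB (x * a⁻¹) (y * b⁻¹) (eA _ (by simp [sa, hx]))
        (eB _ (by simp [sb, ← h, hx]))) hab
      simpa using this


/-- the normal subgroups of `S_i × S_k` are exactly the products of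
normal subgroups, together with the subgroup of pairs of permutations with the same
signature. -/
theorem stmt_11 (i k : ℕ) (N : Subgroup (Equiv.Perm (Fin i) × Equiv.Perm (Fin k))) :
    N.Normal ↔
      ((∃ (N₁ : Subgroup (Equiv.Perm (Fin i))) (N₂ : Subgroup (Equiv.Perm (Fin k))),
          N₁.Normal ∧ N₂.Normal ∧ N = N₁.prod N₂) ∨
        (∀ p : Equiv.Perm (Fin i) × Equiv.Perm (Fin k),
          p ∈ N ↔ Equiv.Perm.sign p.1 = Equiv.Perm.sign p.2)) := by
  constructor
  · exact aux_main i k N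
  · rintro (⟨N₁, N₂, h1, h2, rfl⟩ | h)
    · exact Subgroup.prod_normal N₁ N₂
    · refine ⟨fun p hp g => ?_⟩
      rw [h] at hp ⊢
      simp only [Prod.fst_mul, Prod.snd_mul, Prod.fst_inv, Prod.snd_inv, map_mul, map_inv, hp]
      rw [mul_inv_cancel_comm, mul_inv_cancel_comm]
end

section
/- Let F be a field, n a natural number, and A an n × n matrix over F with A ≠ 0. Then A is a non-zero scalar multiple of the identity matrix (i.e., there exists λ ∈ F with λ ≠ 0 and A = λ • 1) if and only if A fixes every subspace of F^n of dimension n − 1, i.e., for every submodule W of (Fin n → F) with Module.finrank F W = n − 1, the image of W under the linear map A.mulVecLin is contained in W. -/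
/-- a nonzero `n × n` matrix over a field is a nonzero scalar multiple
of the identity iff it fixes every subspace of `F^n` of dimension `n - 1`. -/
theorem stmt_12 {F : Type*} [Field F] {n : ℕ} (A : Matrix (Fin n) (Fin n) F)
    (hA : A ≠ 0) :
    (∃ lam : F, lam ≠ 0 ∧ A = lam • (1 : Matrix (Fin n) (Fin n) F)) ↔
      (∀ W : Submodule F (Fin n → F), Module.finrank F W = n - 1 →
        W.map A.mulVecLin ≤ W) := by
  constructor
  · rintro ⟨lam, -, rfl⟩ W -
    rintro _ ⟨v, hv, rfl⟩
    simpa [Matrix.smul_mulVec] using W.smul_mem lam hv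
  · intro h
    have key : ∀ f : (Fin n → F) →ₗ[F] F, f ≠ 0 → ∀ v, f v = 0 → f (A.mulVec v) = 0 := by
      intro f hf v hv
      have h1 := Module.Dual.finrank_ker_add_one_of_ne_zero hf
      rw [Module.finrank_fin_fun] at h1
      have h2 := h (LinearMap.ker f) (by omega)
      exact h2 ⟨v, hv, rfl⟩
    have off : ∀ i j, i ≠ j → A i j = 0 := by
      intro i j hij
      have := key (LinearMap.proj i) (fun h0 => by
        simpa using LinearMap.congr_fun h0 (Pi.single i 1)) (Pi.single j 1) (by simp [hij])
      simpa using this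
    have dg : ∀ i j, A i i = A j j := by
      intro i j
      by_cases hij : i = j
      · rw [hij]
      have := key ((LinearMap.proj i : (Fin n → F) →ₗ[F] F) - (LinearMap.proj j : (Fin n → F) →ₗ[F] F)) (fun h0 => by
        simpa [LinearMap.sub_apply, Ne.symm hij] using LinearMap.congr_fun h0 (Pi.single i 1))
        (Pi.single i 1 + Pi.single j 1) (by simp [LinearMap.sub_apply, hij, Ne.symm hij])
      simp [LinearMap.sub_apply, Matrix.mulVec_add, off i j hij, off j i (Ne.symm hij)] at this
      exact sub_eq_zero.1 this
    rcases n with _ | n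
    · exact absurd (Subsingleton.elim A 0) hA
    have e : A = A 0 0 • (1 : Matrix (Fin (n+1)) (Fin (n+1)) F) := by
      ext i j
      by_cases hij : i = j
      · subst hij; simpa using dg i 0
      · simp [hij, off i j hij]
    refine ⟨A 0 0, fun h0 => hA ?_, e⟩
    rw [e, h0, zero_smul]
end

section
/- Let F be a field and let θ be a monoid congruence on F_m × F_n. Let A, A' ∈ F_m with rank A' ≤ rank A. Then for all B, B' ∈ F_n, if (A, B) θ (A, B') then (A', B) θ (A', B'). In particular, if rank A = rank A', then for all B, B', (A, B) θ (A, B') if and only if (A', B) θ (A', B'). -/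
theorem stmt_13_factor {F : Type*} [Field F] {m : ℕ}
    (A A' : Matrix (Fin m) (Fin m) F) (h : A'.rank ≤ A.rank) :
    ∃ P Q : Matrix (Fin m) (Fin m) F, A' = P * A * Q := by
  have hf : Module.finrank F (LinearMap.range (Matrix.toLin' A'))
      ≤ Module.finrank F (LinearMap.range (Matrix.toLin' A)) := h
  obtain ⟨i, hi⟩ : ∃ i : LinearMap.range (Matrix.toLin' A') →ₗ[F]
      LinearMap.range (Matrix.toLin' A), Function.Injective i := by
    rw [← finrank_le_iff_exists_linearMap]
    exact hf
  obtain ⟨j, hj⟩ := LinearMap.exists_leftInverse_of_injective i (LinearMap.ker_eq_bot.2 hi)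
  obtain ⟨s, hs⟩ := LinearMap.exists_rightInverse_of_surjective
    (Matrix.toLin' A).rangeRestrict (LinearMap.range_rangeRestrict _)
  obtain ⟨p, hp⟩ := LinearMap.exists_extend
    ((LinearMap.range (Matrix.toLin' A')).subtype ∘ₗ j)
  refine ⟨LinearMap.toMatrix' p,
    LinearMap.toMatrix' (s ∘ₗ i ∘ₗ (Matrix.toLin' A').rangeRestrict), ?_⟩
  apply Matrix.toLin'.injective
  rw [Matrix.toLin'_mul, Matrix.toLin'_mul, Matrix.toLin'_toMatrix', Matrix.toLin'_toMatrix']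
  refine LinearMap.ext fun x => ?_
  have h1 := LinearMap.congr_fun hs (i ((Matrix.toLin' A').rangeRestrict x))
  have h2 := LinearMap.congr_fun hp (i ((Matrix.toLin' A').rangeRestrict x))
  have h3 := LinearMap.congr_fun hj ((Matrix.toLin' A').rangeRestrict x)
  have h4 := congrArg Subtype.val h1
  have h5 := congrArg Subtype.val h3
  simp only [LinearMap.comp_apply, LinearMap.id_apply, LinearMap.codRestrict_apply,
    LinearMap.rangeRestrict, Submodule.subtype_apply] at h2 h4 h5 ⊢
  rw [h4, h2, h5]

theorem stmt_13_aux {F : Type*} [Field F] {m n : ℕ}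
    (θ : Con (Matrix (Fin m) (Fin m) F × Matrix (Fin n) (Fin n) F))
    (A A' : Matrix (Fin m) (Fin m) F) (h : A'.rank ≤ A.rank)
    (B B' : Matrix (Fin n) (Fin n) F) (hθ : θ (A, B) (A, B')) : θ (A', B) (A', B') := by
  obtain ⟨P, Q, rfl⟩ := stmt_13_factor A A' h
  have := θ.mul (θ.mul (θ.refl (P, 1)) hθ) (θ.refl (Q, 1))
  simpa using this

/-- For a congruence `θ` on `F_m × F_n` and matrices `A, A'` with
`rank A' ≤ rank A`, if `(A, B) θ (A, B')` then `(A', B) θ (A', B')`; and if the ranks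
are equal, `(A, B) θ (A, B') ↔ (A', B) θ (A', B')`. -/
theorem stmt_13 {F : Type*} [Field F] {m n : ℕ}
    (θ : Con (Matrix (Fin m) (Fin m) F × Matrix (Fin n) (Fin n) F))
    (A A' : Matrix (Fin m) (Fin m) F) (h : A'.rank ≤ A.rank) :
    (∀ B B' : Matrix (Fin n) (Fin n) F, θ (A, B) (A, B') → θ (A', B) (A', B')) ∧
      (A.rank = A'.rank →
        ∀ B B' : Matrix (Fin n) (Fin n) F, θ (A, B) (A, B') ↔ θ (A', B) (A', B')) := by
  exact ⟨stmt_13_aux θ A A' h, fun e B B' =>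
    ⟨stmt_13_aux θ A A' h B B', stmt_13_aux θ A' A e.le B B'⟩⟩
end

section
/- Let F be a field and let I be a nonempty subset of F_m × F_n. Then I is a two-sided ideal of the monoid F_m × F_n (i.e., for every p ∈ I and every x, y ∈ F_m × F_n, x * p * y ∈ I) if and only if I is downward closed under componentwise rank: for every (A, B) ∈ I and every (A', B') ∈ F_m × F_n with rank A' ≤ rank A and rank B' ≤ rank B, one has (A', B') ∈ I. -/
/-- If `rank B ≤ rank A` then `B` is a two-sided multiple of `A`. -/
theorem exists_mul_mul_of_rank_le {F : Type*} [Field F] {r : ℕ}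
    (A B : Matrix (Fin r) (Fin r) F) (h : B.rank ≤ A.rank) :
    ∃ X Y : Matrix (Fin r) (Fin r) F, X * A * Y = B := by
  set f := Matrix.toLin' A with hf
  set g := Matrix.toLin' B with hg
  have h' : Module.finrank F (LinearMap.range g) ≤ Module.finrank F (LinearMap.range f) := h
  obtain ⟨j, hj⟩ : ∃ j : LinearMap.range g →ₗ[F] LinearMap.range f, Function.Injective j :=
    finrank_le_iff_exists_linearMap.1 h'
  obtain ⟨s, hs⟩ := f.rangeRestrict.exists_rightInverse_of_surjective f.range_rangeRestrict
  obtain ⟨l, hl⟩ := ((LinearMap.range f).subtype ∘ₗ j).exists_leftInverse_of_injective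
    (LinearMap.ker_eq_bot.2 (Subtype.val_injective.comp hj))
  refine ⟨LinearMap.toMatrix' ((LinearMap.range g).subtype ∘ₗ l),
    LinearMap.toMatrix' (s ∘ₗ j ∘ₗ g.rangeRestrict), ?_⟩
  apply Matrix.toLin'.injective
  rw [Matrix.toLin'_mul, Matrix.toLin'_mul, Matrix.toLin'_toMatrix', Matrix.toLin'_toMatrix',
    ← hf, ← hg]
  refine LinearMap.ext fun v => ?_
  have h1 : f (s (j (g.rangeRestrict v))) = (j (g.rangeRestrict v) : Fin r → F) :=
    congrArg Subtype.val (LinearMap.congr_fun hs (j (g.rangeRestrict v)))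
  have h2 : l (j (g.rangeRestrict v) : Fin r → F) = g.rangeRestrict v :=
    LinearMap.congr_fun hl (g.rangeRestrict v)
  change ((l (f (s (j (g.rangeRestrict v)))) : LinearMap.range g) : Fin r → F) = g v
  rw [h1, h2]
  rfl


/-- A nonempty subset of `F_m × F_n` is a two-sided ideal iff it is
downward closed under componentwise rank. -/
theorem stmt_14 {F : Type*} [Field F] {m n : ℕ}
    (I : Set (Matrix (Fin m) (Fin m) F × Matrix (Fin n) (Fin n) F)) (hne : I.Nonempty) :
    (∀ p ∈ I, ∀ x y : Matrix (Fin m) (Fin m) F × Matrix (Fin n) (Fin n) F,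
        x * p * y ∈ I) ↔
      (∀ p ∈ I, ∀ q : Matrix (Fin m) (Fin m) F × Matrix (Fin n) (Fin n) F,
        q.1.rank ≤ p.1.rank → q.2.rank ≤ p.2.rank → q ∈ I) := by
  constructor
  · rintro h p hp ⟨q₁, q₂⟩ h1 h2
    obtain ⟨X, Y, hXY⟩ := exists_mul_mul_of_rank_le p.1 q₁ h1
    obtain ⟨Z, W, hZW⟩ := exists_mul_mul_of_rank_le p.2 q₂ h2
    have := h p hp (X, Z) (Y, W)
    have e : (X, Z) * p * (Y, W) = (q₁, q₂) := Prod.ext hXY hZW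
    rwa [e] at this
  · intro h p hp x y
    exact h p hp _ ((Matrix.rank_mul_le_left _ _).trans (Matrix.rank_mul_le_right _ _))
      ((Matrix.rank_mul_le_left _ _).trans (Matrix.rank_mul_le_right _ _))
end

section
/- Let F be a field, K, K' ∈ F_m and L, L' ∈ F_n, let θ be the principal congruence on F_m × F_n generated by ((K, L), (K', L')), and let j = max(rank K, rank K'). If K and K' are not H-related, then at least one of the following holds: (i) for all M, M' ∈ F_m with rank M ≤ j and rank M' ≤ j, (M, L) θ (M', L); or (ii) for all M, M' ∈ F_m with rank M ≤ j and rank M' ≤ j, (M, L') θ (M', L'). (That is, θ_L or θ_{L'} contains the Rees congruence of F_m determined by the ideal of matrices of rank at most j.) -/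
/-- `A` and `B` are H-related in `F_r`: same column space and same kernel. -/
def HRelM {F : Type*} [Field F] {r : ℕ} (A B : Matrix (Fin r) (Fin r) F) : Prop :=
  LinearMap.range A.mulVecLin = LinearMap.range B.mulVecLin ∧
    LinearMap.ker A.mulVecLin = LinearMap.ker B.mulVecLin

lemma aux_inj {F : Type*} [Field F] {m : ℕ} {A B : Matrix (Fin m) (Fin m) F}
    (h : A.mulVecLin = B.mulVecLin) : A = B :=
  Matrix.toLin'.injective h

open Module in
lemma aux_auto {F V : Type*} [Field F] [AddCommGroup V] [Module F V] [FiniteDimensional F V]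
    (x y : V) (hx : x ≠ 0) (hy : y ≠ 0) : ∃ g : V ≃ₗ[F] V, g x = y := by
  let ex := LinearEquiv.toSpanNonzeroSingleton F V x hx
  let ey := LinearEquiv.toSpanNonzeroSingleton F V y hy
  obtain ⟨g, hg⟩ := Submodule.exists_linearEquiv_restrict_eq (ex.symm.trans ey)
  refine ⟨g, ?_⟩
  have h1 := hg (ex 1)
  have h2 : ((ex 1 : Submodule.span F {x}) : V) = x := by simp [ex]
  have h3 : ((ey 1 : Submodule.span F {y}) : V) = y := by simp [ey]
  rw [h2] at h1
  rw [← h1, LinearEquiv.trans_apply, LinearEquiv.symm_apply_apply, h3]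

open Module in
lemma aux_compl {F V : Type*} [Field F] [AddCommGroup V] [Module F V]
    (p : Submodule F V) (u : V) (hu : u ∉ p) : ∃ q : Submodule F V, IsCompl p q ∧ u ∈ q := by
  have hd : Disjoint (Submodule.span F {u}) p := by
    rw [disjoint_comm]
    refine (Submodule.disjoint_span_singleton' ?_).2 hu
    rintro rfl
    exact hu p.zero_mem
  obtain ⟨q, hq, hc⟩ := hd.exists_isCompl
  exact ⟨q, hc.symm, hq (Submodule.mem_span_singleton_self u)⟩

open Module in
lemma aux_drop {F U V W : Type*} [Field F] [AddCommGroup U] [Module F U] [AddCommGroup V]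
    [Module F V] [FiniteDimensional F V] [AddCommGroup W] [Module F W]
    (g : U →ₗ[F] V) (f : V →ₗ[F] W) (u : V) (hu : u ≠ 0) (hug : u ∈ LinearMap.range g)
    (hfu : f u = 0) :
    finrank F (LinearMap.range (f ∘ₗ g)) < finrank F (LinearMap.range g) := by
  let h := f.domRestrict (LinearMap.range g)
  have h1 : LinearMap.range (f ∘ₗ g) = LinearMap.range h := by
    rw [LinearMap.range_comp, LinearMap.range_domRestrict]
  have h2 := LinearMap.finrank_range_add_finrank_ker h
  have h3 : LinearMap.ker h ≠ ⊥ := by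
    intro hb
    have : (⟨u, hug⟩ : LinearMap.range g) ∈ LinearMap.ker h := by simpa [h] using hfu
    rw [hb, Submodule.mem_bot] at this
    exact hu (congrArg Subtype.val this)
  have h4 := Submodule.one_le_finrank_iff.2 h3
  rw [h1]
  omega

open Module in
lemma aux_fac {F V : Type*} [Field F] [AddCommGroup V] [Module F V] [FiniteDimensional F V]
    (A B M : V →ₗ[F] V)
    (hAB : finrank F (LinearMap.range B) < finrank F (LinearMap.range A))
    (hM : finrank F (LinearMap.range M) ≤ finrank F (LinearMap.range A)) (hM0 : M ≠ 0) :
    ∃ P Q : V →ₗ[F] V, P ∘ₗ A ∘ₗ Q = M ∧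
      finrank F (LinearMap.range (P ∘ₗ B ∘ₗ Q)) < finrank F (LinearMap.range M) := by
  have hnot : ¬ LinearMap.ker B ≤ LinearMap.ker A := by
    intro h
    have h1 := Submodule.finrank_mono h
    have h2 := LinearMap.finrank_range_add_finrank_ker A
    have h3 := LinearMap.finrank_range_add_finrank_ker B
    omega
  obtain ⟨v, hvB, hvA⟩ := SetLike.not_le_iff_exists.1 hnot
  obtain ⟨C, hC, hvC⟩ := aux_compl _ v hvA
  have hv0 : v ≠ 0 := by rintro rfl; exact hvA (Submodule.zero_mem _)
  have hCr : finrank F C = finrank F (LinearMap.range A) := by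
    have h1 := Submodule.finrank_add_eq_of_isCompl hC
    have h2 := LinearMap.finrank_range_add_finrank_ker A
    omega
  obtain ⟨w, hw⟩ : ∃ w, M w ≠ 0 := by
    by_contra! h
    exact hM0 (LinearMap.ext h)
  obtain ⟨f0, hf0⟩ := (rank_le_iff_exists_linearMap (R := F) (M := LinearMap.range M) (M₁ := C)).1
    (by rw [← finrank_eq_rank, ← finrank_eq_rank]; exact_mod_cast hM.trans hCr.ge)
  have hx0 : f0 ⟨M w, w, rfl⟩ ≠ 0 := by
    intro h
    have := hf0 (h.trans (map_zero f0).symm)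
    exact hw (congrArg Subtype.val this)
  obtain ⟨g, hg⟩ := aux_auto (F := F) (f0 ⟨M w, w, rfl⟩) (⟨v, hvC⟩ : C) hx0
    (by intro h; exact hv0 (congrArg Subtype.val h))
  let f : LinearMap.range M →ₗ[F] V := C.subtype ∘ₗ g.toLinearMap ∘ₗ f0
  have hf : Function.Injective f :=
    C.injective_subtype.comp (g.injective.comp hf0)
  have hker : LinearMap.ker (A ∘ₗ f) = ⊥ := by
    rw [LinearMap.ker_eq_bot']
    intro x hx
    have h1 : f x ∈ LinearMap.ker A := hx
    have h2 : f x ∈ C := (g (f0 x)).2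
    have h3 : f x = 0 := Submodule.disjoint_def.1 hC.disjoint _ h1 h2
    exact hf (h3.trans (map_zero f).symm)
  obtain ⟨p, hp⟩ := LinearMap.exists_leftInverse_of_injective _ hker
  let Q : V →ₗ[F] V := f ∘ₗ M.rangeRestrict
  have hQ : finrank F (LinearMap.range Q) ≤ finrank F (LinearMap.range M) := by
    have : LinearMap.range Q ≤ LinearMap.range f := LinearMap.range_comp_le_range _ _
    exact (Submodule.finrank_mono this).trans (LinearMap.finrank_range_le f)
  refine ⟨(LinearMap.range M).subtype ∘ₗ p, Q, ?_, ?_⟩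
  · ext x
    have := LinearMap.congr_fun hp (M.rangeRestrict x)
    exact congrArg Subtype.val this
  · refine lt_of_lt_of_le ?_ hQ
    have := aux_drop Q (((LinearMap.range M).subtype ∘ₗ p) ∘ₗ B) v hv0
      ⟨w, by
        change ((g (f0 ⟨M w, w, rfl⟩) : C) : V) = v
        rw [hg]⟩
      (by
        have : B v = 0 := hvB
        simp [this])
    exact this

lemma aux_rees {F : Type*} [Field F] {m : ℕ} (c : Con (Matrix (Fin m) (Fin m) F))
    (A B : Matrix (Fin m) (Fin m) F) (hAB : B.rank < A.rank) (h : c A B) :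
    ∀ (k : ℕ) (M : Matrix (Fin m) (Fin m) F), M.rank ≤ k → M.rank ≤ A.rank → c M 0 := by
  intro k
  induction k with
  | zero =>
    intro M hM _
    have : M = 0 := by
      have h0 : M.mulVecLin = 0 := by
        rw [← LinearMap.range_eq_bot]
        exact Submodule.finrank_eq_zero.1 (Nat.le_zero.1 hM)
      exact aux_inj (h0.trans Matrix.mulVecLin_zero.symm)
    rw [this]
    exact c.refl 0
  | succ k ih =>
    intro M hM hMA
    by_cases hM0 : M = 0
    · rw [hM0]; exact c.refl 0
    obtain ⟨P, Q, h1, h2⟩ := aux_fac A.mulVecLin B.mulVecLin M.mulVecLin hAB hMA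
      (fun h0 => hM0 (aux_inj (h0.trans Matrix.mulVecLin_zero.symm)))
    set P' := LinearMap.toMatrix' P
    set Q' := LinearMap.toMatrix' Q
    have hP : P'.mulVecLin = P := Matrix.toLin'_toMatrix' P
    have hQ : Q'.mulVecLin = Q := Matrix.toLin'_toMatrix' Q
    have e1 : P' * (A * Q') = M := by
      apply aux_inj
      rw [Matrix.mulVecLin_mul, Matrix.mulVecLin_mul, hP, hQ, h1]
    have e2 : (P' * (B * Q')).rank < M.rank := by
      unfold Matrix.rank
      rw [Matrix.mulVecLin_mul, Matrix.mulVecLin_mul, hP, hQ]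
      exact h2
    have e3 : c (P' * (A * Q')) (P' * (B * Q')) := c.mul (c.refl _) (c.mul h (c.refl _))
    rw [e1] at e3
    exact c.trans e3 (ih _ (by omega) (by omega))

/-- The slice of a congruence at a fixed second coordinate. -/
def sliceCon {S T : Type*} [Monoid S] [Monoid T] (c : Con (S × T)) (l : T) : Con S where
  r a b := c (a, l) (b, l)
  iseqv := ⟨fun _ => c.refl _, fun h => c.symm h, fun h h' => c.trans h h'⟩
  mul' := by
    intro a b x y h h'
    have h1 : c (a * x, l) (b * x, l) := by
      simpa using c.mul h (c.refl (x, (1 : T)))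
    have h2 : c (b * x, l) (b * y, l) := by
      simpa using c.mul (c.refl (b, (1 : T))) h'
    exact c.trans h1 h2

lemma aux_slice {F : Type*} [Field F] {m n : ℕ}
    (c : Con (Matrix (Fin m) (Fin m) F × Matrix (Fin n) (Fin n) F))
    (A B : Matrix (Fin m) (Fin m) F) (L : Matrix (Fin n) (Fin n) F) (hAB : B.rank < A.rank)
    (h : c (A, L) (B, L)) (M M' : Matrix (Fin m) (Fin m) F) (hM : M.rank ≤ A.rank)
    (hM' : M'.rank ≤ A.rank) : c (M, L) (M', L) := by
  have h1 := aux_rees (sliceCon c L) A B hAB h _ M le_rfl hM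
  have h2 := aux_rees (sliceCon c L) A B hAB h _ M' le_rfl hM'
  exact (sliceCon c L).trans h1 ((sliceCon c L).symm h2)

lemma aux_projLeft {F : Type*} [Field F] {m : ℕ} (A : Matrix (Fin m) (Fin m) F)
    (D : Submodule F (Fin m → F)) (hD : IsCompl (LinearMap.range A.mulVecLin) D) :
    ∃ X : Matrix (Fin m) (Fin m) F, X * A = A ∧
      X.mulVecLin = (LinearMap.range A.mulVecLin).projection D hD := by
  refine ⟨LinearMap.toMatrix' ((LinearMap.range A.mulVecLin).projection D hD), ?_,
    Matrix.toLin'_toMatrix' _⟩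
  apply aux_inj
  rw [Matrix.mulVecLin_mul, show (LinearMap.toMatrix' _).mulVecLin = _ from
    Matrix.toLin'_toMatrix' ((LinearMap.range A.mulVecLin).projection D hD)]
  refine LinearMap.ext fun x => ?_
  exact Submodule.projection_apply_left hD ⟨A.mulVecLin x, x, rfl⟩

lemma aux_projRight {F : Type*} [Field F] {m : ℕ} (A : Matrix (Fin m) (Fin m) F)
    (C : Submodule F (Fin m → F)) (hC : IsCompl C (LinearMap.ker A.mulVecLin)) :
    ∃ Y : Matrix (Fin m) (Fin m) F, A * Y = A ∧
      Y.mulVecLin = C.projection _ hC := by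
  refine ⟨LinearMap.toMatrix' (C.projection _ hC), ?_, Matrix.toLin'_toMatrix' _⟩
  apply aux_inj
  rw [Matrix.mulVecLin_mul, show (LinearMap.toMatrix' _).mulVecLin = _ from
    Matrix.toLin'_toMatrix' (C.projection _ hC)]
  refine LinearMap.ext fun x => ?_
  have := Submodule.sub_projection_mem hC x
  rw [LinearMap.mem_ker, map_sub, sub_eq_zero] at this
  exact this.symm

lemma aux_main_s15 {F : Type*} [Field F] {m n : ℕ}
    (c : Con (Matrix (Fin m) (Fin m) F × Matrix (Fin n) (Fin n) F))
    (K K' : Matrix (Fin m) (Fin m) F) (L L' : Matrix (Fin n) (Fin n) F)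
    (hKK : ¬ HRelM K K') (h : c (K, L) (K', L')) (hr : K'.rank ≤ K.rank) :
    (∀ M M' : Matrix (Fin m) (Fin m) F, M.rank ≤ K.rank → M'.rank ≤ K.rank →
        c (M, L) (M', L)) ∨
    (∀ M M' : Matrix (Fin m) (Fin m) F, M.rank ≤ K.rank → M'.rank ≤ K.rank →
        c (M, L') (M', L')) := by
  rcases hr.lt_or_eq with hlt | heq
  · left
    obtain ⟨D, hD⟩ := Submodule.exists_isCompl (LinearMap.range K'.mulVecLin)
    obtain ⟨X, hX, hXp⟩ := aux_projLeft K' D hD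
    have hXr : X.rank = K'.rank := by
      unfold Matrix.rank
      rw [hXp, Submodule.range_projection]
    have h1 : c (X * K, L) (K', L') := by
      have := c.mul (c.refl (X, (1 : Matrix (Fin n) (Fin n) F))) h
      simpa [hX] using this
    intro M M' hM hM'
    exact aux_slice c K (X * K) L
      (lt_of_le_of_lt (Matrix.rank_mul_le_left X K) (by omega))
      (c.trans h (c.symm h1)) M M' hM hM'
  · right
    have hlin1 := LinearMap.finrank_range_add_finrank_ker K.mulVecLin
    have hlin2 := LinearMap.finrank_range_add_finrank_ker K'.mulVecLin
    have heq' : Module.finrank F (LinearMap.range K'.mulVecLin)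
      = Module.finrank F (LinearMap.range K.mulVecLin) := heq
    by_cases hker : LinearMap.ker K.mulVecLin = LinearMap.ker K'.mulVecLin
    · have hran : ¬ LinearMap.range K'.mulVecLin ≤ LinearMap.range K.mulVecLin := by
        intro hle
        exact hKK ⟨(Submodule.eq_of_le_of_finrank_eq hle heq').symm, hker⟩
      obtain ⟨u, hu', hu⟩ := SetLike.not_le_iff_exists.1 hran
      obtain ⟨D, hD, huD⟩ := aux_compl _ u hu
      obtain ⟨X, hX, hXp⟩ := aux_projLeft K D hD
      have hlt : (X * K').rank < K'.rank := by
        unfold Matrix.rank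
        rw [Matrix.mulVecLin_mul]
        refine aux_drop _ _ u ?_ hu' ?_
        · rintro rfl; exact hu (Submodule.zero_mem _)
        · rw [hXp]; exact (Submodule.projection_apply_eq_zero_iff hD).2 huD
      have h1 : c (K, L) (X * K', L') := by
        have := c.mul (c.refl (X, (1 : Matrix (Fin n) (Fin n) F))) h
        simpa [hX] using this
      intro M M' hM hM'
      exact aux_slice c K' (X * K') L' hlt (c.trans (c.symm h) h1) M M'
        (by omega) (by omega)
    · have hk : ¬ LinearMap.ker K'.mulVecLin ≤ LinearMap.ker K.mulVecLin := by
        intro hle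
        exact hker (Submodule.eq_of_le_of_finrank_eq hle (by omega)).symm
      obtain ⟨u, hu', hu⟩ := SetLike.not_le_iff_exists.1 hk
      obtain ⟨C, hC, huC⟩ := aux_compl _ u hu
      obtain ⟨Y, hY, hYp⟩ := aux_projRight K C hC.symm
      have hYr : Y.rank = K.rank := by
        have h1 := Submodule.finrank_add_eq_of_isCompl hC
        unfold Matrix.rank
        rw [hYp, Submodule.range_projection]
        omega
      have hlt : (K' * Y).rank < Y.rank := by
        unfold Matrix.rank
        rw [Matrix.mulVecLin_mul]
        refine aux_drop _ _ u ?_ ?_ hu'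
        · rintro rfl; exact hu (Submodule.zero_mem _)
        · rw [hYp, Submodule.range_projection]; exact huC
      have h1 : c (K, L) (K' * Y, L') := by
        have := c.mul h (c.refl (Y, (1 : Matrix (Fin n) (Fin n) F)))
        simpa [hY] using this
      intro M M' hM hM'
      exact aux_slice c K' (K' * Y) L' (by omega) (c.trans (c.symm h) h1) M M'
        (by omega) (by omega)


/-- if `K, K'` are not H-related, then `θ_L` or `θ_{L'}` contains the
Rees congruence of `F_m` determined by the ideal of matrices of rank at most
`j = max (rank K) (rank K')`. -/
theorem stmt_15 {F : Type*} [Field F] {m n : ℕ}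
    (K K' : Matrix (Fin m) (Fin m) F) (L L' : Matrix (Fin n) (Fin n) F)
    (hKK : ¬ HRelM K K') :
    (∀ M M' : Matrix (Fin m) (Fin m) F,
        M.rank ≤ max K.rank K'.rank → M'.rank ≤ max K.rank K'.rank →
        conGen (fun p q : Matrix (Fin m) (Fin m) F × Matrix (Fin n) (Fin n) F =>
          p = (K, L) ∧ q = (K', L')) (M, L) (M', L)) ∨
    (∀ M M' : Matrix (Fin m) (Fin m) F,
        M.rank ≤ max K.rank K'.rank → M'.rank ≤ max K.rank K'.rank →
        conGen (fun p q : Matrix (Fin m) (Fin m) F × Matrix (Fin n) (Fin n) F =>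
          p = (K, L) ∧ q = (K', L')) (M, L') (M', L')) := by
  have h := ConGen.Rel.of (r := fun p q : Matrix (Fin m) (Fin m) F × Matrix (Fin n) (Fin n) F =>
          p = (K, L) ∧ q = (K', L')) (K, L) (K', L') ⟨rfl, rfl⟩
  rcases le_total K'.rank K.rank with hr | hr
  · rw [max_eq_left hr]
    exact aux_main_s15 _ K K' L L' hKK h hr
  · rw [max_eq_right hr]
    exact (aux_main_s15 _ K' K L' L (fun hh => hKK ⟨hh.1.symm, hh.2.symm⟩) (Con.symm _ h) hr).symm
end

section
/- Let F be a field, K, K' ∈ F_m and L, L' ∈ F_n be such that K, K' are not H-related and L, L' are not H-related. Set i = rank K, j = rank K', k = rank L, l = rank L'. Let θ be the principal congruence on F_m × F_n generated by ((K, L), (K', L')). Then θ is the Rees congruence determined by the ideal I = (I_i × I_k) ∪ (I_j × I_l): for all (M, N), (M', N') ∈ F_m × F_n, (M, N) θ (M', N') if and only if (M, N) = (M', N'), or both (M, N) and (M', N') lie in I, where (X, Y) ∈ I means (rank X ≤ i and rank Y ≤ k) or (rank X ≤ j and rank Y ≤ l). -/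
section Helpers

open Module LinearMap

variable {F V : Type*} [Field F] [AddCommGroup V] [Module F V] [FiniteDimensional F V]

theorem hx_exists_equiv {W : Type*} [AddCommGroup W] [Module F W]
    {v w : W} (hv : v ≠ 0) (hw : w ≠ 0) : ∃ h : W ≃ₗ[F] W, h v = w := by
  let f := (LinearEquiv.toSpanNonzeroSingleton F W v hv).symm ≪≫ₗ
    LinearEquiv.toSpanNonzeroSingleton F W w hw
  obtain ⟨g, hg⟩ := Submodule.exists_linearEquiv_restrict_eq f
  refine ⟨g, ?_⟩
  have h1 := hg (LinearEquiv.toSpanNonzeroSingleton F W v hv 1)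
  have h2 : f (LinearEquiv.toSpanNonzeroSingleton F W v hv 1) =
      LinearEquiv.toSpanNonzeroSingleton F W w hw 1 := by
    simp only [f, LinearEquiv.trans_apply, LinearEquiv.symm_apply_apply]
  rw [h2] at h1
  simpa [LinearEquiv.toSpanNonzeroSingleton_apply] using h1.symm

theorem hx_rank_lt (A Y : V →ₗ[F] V) (b : V) (hb : b ∈ range A) (hb0 : b ≠ 0) (hY : Y b = 0) :
    finrank F (range (Y ∘ₗ A)) < finrank F (range A) := by
  have h1 : range (Y ∘ₗ A) = range (Y.domRestrict (range A)) := by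
    ext x
    simp [LinearMap.mem_range]
  have h2 := LinearMap.finrank_range_add_finrank_ker (Y.domRestrict (range A))
  have h3 : 0 < finrank F (ker (Y.domRestrict (range A))) := by
    rw [Module.finrank_pos_iff_exists_ne_zero]
    refine ⟨⟨⟨b, hb⟩, by simpa using hY⟩, ?_⟩
    simpa using hb0
  rw [h1]; omega

theorem hx_section (K : V →ₗ[F] V) :
    ∃ (s : range K →ₗ[F] V) (p : V →ₗ[F] range K),
      (∀ r, K (s r) = r) ∧ (∀ r : range K, p r = r) := by
  obtain ⟨s, hs⟩ := K.rangeRestrict.exists_rightInverse_of_surjective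
    (LinearMap.range_rangeRestrict K)
  obtain ⟨p, hp⟩ := (range K).subtype.exists_leftInverse_of_injective (by simp)
  refine ⟨s, p, fun r => ?_, fun r => ?_⟩
  · have := congrArg (fun f => ((f r : range K) : V)) hs
    simpa using this
  · have := congrArg (fun f => f r) hp
    simpa using this

theorem hx_regular (K : V →ₗ[F] V) : ∃ z : V →ₗ[F] V, K ∘ₗ z ∘ₗ K = K := by
  obtain ⟨s, p, hs, hp⟩ := hx_section K
  refine ⟨s ∘ₗ p, LinearMap.ext fun x => ?_⟩
  have := hp ⟨K x, x, rfl⟩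
  simp only [LinearMap.comp_apply]
  rw [this, hs]

theorem hx_step (K A : V →ₗ[F] V) (hA : A ≠ 0) (h : finrank F (range A) < finrank F (range K)) :
    ∃ c x : V →ₗ[F] V, c ∘ₗ K ∘ₗ x ∘ₗ K = K ∧
      finrank F (range ((A ∘ₗ x) ∘ₗ A)) < finrank F (range A) := by
  obtain ⟨s, p, hs, hp⟩ := hx_section K
  obtain ⟨y, hy⟩ : ∃ y, A y ≠ 0 := by
    by_contra! hc
    exact hA (LinearMap.ext hc)
  obtain ⟨r, hr0, hr⟩ : ∃ r : range K, r ≠ 0 ∧ A (s r) = 0 := by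
    have h1 := LinearMap.finrank_range_add_finrank_ker (A ∘ₗ s)
    have h2 : finrank F (range (A ∘ₗ s)) ≤ finrank F (range A) :=
      Submodule.finrank_mono (LinearMap.range_comp_le_range s A)
    have h3 : 0 < finrank F (ker (A ∘ₗ s)) := by omega
    rw [Module.finrank_pos_iff_exists_ne_zero] at h3
    obtain ⟨⟨r, hr⟩, hr0⟩ := h3
    exact ⟨r, by simpa using hr0, by simpa using hr⟩
  obtain ⟨g, hg⟩ : ∃ g : range K ≃ₗ[F] range K, A (s (g (p (A y)))) = 0 := by
    by_cases hv : p (A y) = 0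
    · exact ⟨LinearEquiv.refl _ _, by simp [hv]⟩
    · obtain ⟨g, hg⟩ := hx_exists_equiv (F := F) hv hr0
      exact ⟨g, by rw [hg, hr]⟩
  refine ⟨(range K).subtype ∘ₗ g.symm.toLinearMap ∘ₗ p, s ∘ₗ g.toLinearMap ∘ₗ p,
    LinearMap.ext fun x => ?_, ?_⟩
  · have := hp ⟨K x, x, rfl⟩
    simp only [LinearMap.comp_apply, this, hs, LinearEquiv.coe_coe, hp, Submodule.subtype_apply,
      LinearEquiv.symm_apply_apply]
  · exact hx_rank_lt A _ (A y) ⟨y, rfl⟩ hy (by simpa using hg)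

theorem hx_factor (K M : V →ₗ[F] V) (h : finrank F (range M) ≤ finrank F (range K)) :
    ∃ X Y : V →ₗ[F] V, M = X ∘ₗ K ∘ₗ Y := by
  obtain ⟨s, p, hs, hp⟩ := hx_section K
  obtain ⟨j, hj⟩ := finrank_le_iff_exists_linearMap.mp h
  obtain ⟨q, hq⟩ := j.exists_leftInverse_of_injective (LinearMap.ker_eq_bot.mpr hj)
  refine ⟨(range M).subtype ∘ₗ q ∘ₗ p, s ∘ₗ j ∘ₗ M.rangeRestrict, LinearMap.ext fun x => ?_⟩
  have := congrArg (fun f => ((f (M.rangeRestrict x) : range M) : V)) hq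
  simp only [LinearMap.comp_apply, hs, hp, Submodule.subtype_apply, LinearMap.id_apply] at this ⊢
  rw [this]; rfl

/-- reduction on kernels -/
theorem hx_ker (K K' : V →ₗ[F] V) (b : V) (hb : K b = 0) (hb' : K' b ≠ 0) :
    ∃ Y : V →ₗ[F] V, K ∘ₗ Y = K ∧ finrank F (range (K' ∘ₗ Y)) < finrank F (range K') := by
  obtain ⟨φ, hφ⟩ := LinearMap.exists_extend_of_notMem (0 : (⊥ : Submodule F V) →ₗ[F] F)
    (v := K' b) (by simpa using hb') 1
  have hφ1 := hφ.2
  refine ⟨LinearMap.id - (φ ∘ₗ K').smulRight b, LinearMap.ext fun x => by simp [hb], ?_⟩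
  have h1 : K' ∘ₗ (LinearMap.id - (φ ∘ₗ K').smulRight b) =
      (LinearMap.id - φ.smulRight (K' b)) ∘ₗ K' := LinearMap.ext fun x => by simp
  rw [h1]
  exact hx_rank_lt _ _ (K' b) ⟨b, rfl⟩ hb' (by simp [hφ1])

/-- reduction on ranges -/
theorem hx_range (K K' : V →ₗ[F] V) (b : V) (hb : b ∉ range K) (hb' : b ∈ range K') :
    ∃ Y : V →ₗ[F] V, Y ∘ₗ K = K ∧ finrank F (range (Y ∘ₗ K')) < finrank F (range K') := by
  obtain ⟨φ, hφ, hφ1⟩ := LinearMap.exists_extend_of_notMem (0 : range K →ₗ[F] F) hb 1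
  have hφ0 : ∀ x, φ (K x) = 0 := fun x => by
    have := congrArg (fun f => f ⟨K x, x, rfl⟩) hφ
    simpa using this
  refine ⟨LinearMap.id - φ.smulRight b, LinearMap.ext fun x => by simp [hφ0], ?_⟩
  exact hx_rank_lt _ _ b hb' (by rintro rfl; simp at hb) (by simp [hφ1])

theorem hx_reduce (K K' : V →ₗ[F] V) (hr : finrank F (range K') ≤ finrank F (range K))
    (hne : ¬ (range K = range K' ∧ ker K = ker K')) :
    ∃ X Y : V →ₗ[F] V, X ∘ₗ K ∘ₗ Y = K ∧
      finrank F (range (X ∘ₗ K' ∘ₗ Y)) < finrank F (range K) := by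
  rcases hr.lt_or_eq with hlt | heq
  · exact ⟨LinearMap.id, LinearMap.id, by simp, by simpa using hlt⟩
  by_cases hrg : range K = range K'
  · have hk : ker K ≠ ker K' := fun h => hne ⟨hrg, h⟩
    have hle : ¬ ker K ≤ ker K' := fun hle => hk <| by
      refine Submodule.eq_of_le_of_finrank_eq hle ?_
      have h1 := LinearMap.finrank_range_add_finrank_ker K
      have h2 := LinearMap.finrank_range_add_finrank_ker K'
      omega
    obtain ⟨b, hb, hb'⟩ := SetLike.not_le_iff_exists.mp hle
    obtain ⟨Y, h1, h2⟩ := hx_ker K K' b (by simpa using hb) (by simpa using hb')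
    exact ⟨LinearMap.id, Y, by simpa using h1, by simpa [heq] using h2⟩
  · have hle : ¬ range K' ≤ range K := fun hle => hrg
      (Submodule.eq_of_le_of_finrank_eq hle heq).symm
    obtain ⟨b, hb, hb'⟩ := SetLike.not_le_iff_exists.mp hle
    obtain ⟨X, h1, h2⟩ := hx_range K K' b hb' hb
    exact ⟨X, LinearMap.id, by simpa using h1, by simpa [heq] using h2⟩

end Helpers

section MatrixHelpers

variable {F : Type*} [Field F] {r m n : ℕ}

theorem hm_lin (X : (Fin r → F) →ₗ[F] (Fin r → F)) :
    (LinearMap.toMatrix' X).mulVecLin = X := by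
  rw [← Matrix.toLin'_apply', Matrix.toLin'_toMatrix']

theorem hm_inj {A B : Matrix (Fin r) (Fin r) F} (h : A.mulVecLin = B.mulVecLin) : A = B := by
  apply Matrix.toLin'.injective
  rwa [Matrix.toLin'_apply', Matrix.toLin'_apply']

theorem hm_regular (K : Matrix (Fin r) (Fin r) F) : ∃ z, K * z * K = K := by
  obtain ⟨z, hz⟩ := hx_regular K.mulVecLin
  refine ⟨LinearMap.toMatrix' z, hm_inj ?_⟩
  simpa [Matrix.mulVecLin_mul, hm_lin, LinearMap.comp_assoc] using hz

theorem hm_step (K A : Matrix (Fin r) (Fin r) F) (hA : A ≠ 0) (h : A.rank < K.rank) :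
    ∃ c x, c * K * x * K = K ∧ (A * x * A).rank < A.rank := by
  obtain ⟨c, x, h1, h2⟩ := hx_step K.mulVecLin A.mulVecLin
    (fun h0 => hA (hm_inj (by simpa using h0))) h
  refine ⟨LinearMap.toMatrix' c, LinearMap.toMatrix' x, hm_inj ?_, ?_⟩
  · simpa only [Matrix.mulVecLin_mul, hm_lin, LinearMap.comp_assoc] using h1
  · have e : (A * LinearMap.toMatrix' x * A).mulVecLin =
        (A.mulVecLin ∘ₗ x) ∘ₗ A.mulVecLin := by
      simp only [Matrix.mulVecLin_mul, hm_lin]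
    rw [Matrix.rank, e]
    exact h2

theorem hm_factor (K M : Matrix (Fin r) (Fin r) F) (h : M.rank ≤ K.rank) :
    ∃ X Y, M = X * K * Y := by
  obtain ⟨X, Y, h1⟩ := hx_factor K.mulVecLin M.mulVecLin h
  refine ⟨LinearMap.toMatrix' X, LinearMap.toMatrix' Y, hm_inj ?_⟩
  simpa only [Matrix.mulVecLin_mul, hm_lin, LinearMap.comp_assoc] using h1

theorem hm_reduce (K K' : Matrix (Fin r) (Fin r) F) (h : K'.rank ≤ K.rank)
    (hne : ¬ HRelM K K') :
    ∃ X Y, X * K * Y = K ∧ (X * K' * Y).rank < K.rank := by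
  obtain ⟨X, Y, h1, h2⟩ := hx_reduce K.mulVecLin K'.mulVecLin h hne
  refine ⟨LinearMap.toMatrix' X, LinearMap.toMatrix' Y, hm_inj ?_, ?_⟩
  · simpa only [Matrix.mulVecLin_mul, hm_lin, LinearMap.comp_assoc] using h1
  · have e : (LinearMap.toMatrix' X * K' * LinearMap.toMatrix' Y).mulVecLin =
        X ∘ₗ K'.mulVecLin ∘ₗ Y := by
      simp only [Matrix.mulVecLin_mul, hm_lin, LinearMap.comp_assoc]
    rw [Matrix.rank, e]
    exact h2

theorem hm_rank_eq_zero {A : Matrix (Fin r) (Fin r) F} (h : A.rank ≤ 0) : A = 0 := by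
  obtain ⟨X, Y, h⟩ := hm_factor 0 A (by simpa using h)
  simpa using h

theorem hm_rank_mul3 (X A Y : Matrix (Fin r) (Fin r) F) : (X * A * Y).rank ≤ A.rank :=
  (Matrix.rank_mul_le_left _ _).trans (Matrix.rank_mul_le_right _ _)

theorem hc_mul {S : Type*} [Monoid S] (c : Con S) {a b : S} (h : c a b) (x y : S) :
    c (x * a * y) (x * b * y) := c.mul (c.mul (c.refl x) h) (c.refl y)

theorem hc_left (c : Con (Matrix (Fin m) (Fin m) F × Matrix (Fin n) (Fin n) F))
    (K : Matrix (Fin m) (Fin m) F) (L : Matrix (Fin n) (Fin n) F) (d : ℕ) :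
    ∀ A B, A.rank ≤ d → A.rank < K.rank → c (K, L) (A, B) →
      ∃ B', B'.rank ≤ B.rank ∧ c (K, L) (0, B') := by
  induction d with
  | zero =>
    intro A B hd _ h
    rw [hm_rank_eq_zero hd] at h
    exact ⟨B, le_rfl, h⟩
  | succ d ih =>
    intro A B hd hlt h
    by_cases hA : A = 0
    · subst hA
      exact ⟨B, le_rfl, h⟩
    obtain ⟨u, x, h1, h2⟩ := hm_step K A hA hlt
    obtain ⟨z, hz⟩ := hm_regular L
    have key := c.mul (hc_mul c h (u, 1) (x, z)) h
    simp only [Prod.mk_mul_mk, one_mul, h1, hz] at key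
    have h3 : (u * A * x * A).rank ≤ (A * x * A).rank := by
      rw [mul_assoc u, mul_assoc u]
      exact Matrix.rank_mul_le_right _ _
    obtain ⟨B', hB', hc⟩ := ih _ _ (by omega) (by omega) key
    exact ⟨B', hB'.trans (Matrix.rank_mul_le_right _ _), hc⟩

theorem hc_right (c : Con (Matrix (Fin m) (Fin m) F × Matrix (Fin n) (Fin n) F))
    (K A : Matrix (Fin m) (Fin m) F) (L B : Matrix (Fin n) (Fin n) F)
    (hlt : B.rank < L.rank) (h : c (K, L) (A, B)) :
      ∃ A', A'.rank ≤ A.rank ∧ c (K, L) (A', 0) := by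
  have := hc_left (Con.comap (Prod.swap) (fun _ _ => rfl) c) L K B.rank B A le_rfl hlt
    (by simpa [Con.comap_rel] using h)
  simpa [Con.comap_rel] using this

theorem hc_main (c : Con (Matrix (Fin m) (Fin m) F × Matrix (Fin n) (Fin n) F))
    (K K' : Matrix (Fin m) (Fin m) F) (L L' : Matrix (Fin n) (Fin n) F)
    (hKK : ¬ HRelM K K') (hLL : ¬ HRelM L L') (hr : K'.rank ≤ K.rank)
    (h : c (K, L) (K', L')) : c (K, L) (0, 0) := by
  obtain ⟨X, Y, h1, h2⟩ := hm_reduce K K' hr hKK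
  have hA := hc_mul c h (X, 1) (Y, 1)
  simp only [Prod.mk_mul_mk, one_mul, mul_one, h1] at hA
  rcases le_total L'.rank L.rank with hl | hl
  · obtain ⟨Z, W, h3, h4⟩ := hm_reduce L L' hl hLL
    have hB := hc_mul c hA (1, Z) (1, W)
    simp only [Prod.mk_mul_mk, one_mul, mul_one, h3] at hB
    obtain ⟨B', hB', hc⟩ := hc_left c K L _ _ _ le_rfl h2 hB
    obtain ⟨A', hA', hc'⟩ := hc_right c K 0 L B' (by omega) hc
    rw [Matrix.rank_zero] at hA'
    rwa [hm_rank_eq_zero hA'] at hc'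
  · have hLL' : ¬ HRelM L' L := fun h => hLL ⟨h.1.symm, h.2.symm⟩
    obtain ⟨Z, W, h3, h4⟩ := hm_reduce L' L hl hLL'
    obtain ⟨B', hB', hc⟩ := hc_left c K L _ _ _ le_rfl h2 hA
    have hB := hc_mul c (c.symm h) (0, Z) (1, W)
    simp only [Prod.mk_mul_mk, zero_mul, h3] at hB
    obtain ⟨A', hA', hc'⟩ := hc_right c 0 0 L' _ h4 hB
    rw [Matrix.rank_zero] at hA'
    rw [hm_rank_eq_zero hA'] at hc'
    obtain ⟨P, Q, hPQ⟩ := hm_factor L' B' hB'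
    have hf := hc_mul c hc' (1, P) (1, Q)
    simp only [Prod.mk_mul_mk, mul_zero, zero_mul, ← hPQ] at hf
    exact c.trans hc hf

theorem hc_ideal (c : Con (Matrix (Fin m) (Fin m) F × Matrix (Fin n) (Fin n) F))
    (K M : Matrix (Fin m) (Fin m) F) (L N : Matrix (Fin n) (Fin n) F)
    (h : c (K, L) (0, 0)) (h1 : M.rank ≤ K.rank) (h2 : N.rank ≤ L.rank) : c (M, N) (0, 0) := by
  obtain ⟨P, Q, hPQ⟩ := hm_factor K M h1
  obtain ⟨R, S, hRS⟩ := hm_factor L N h2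
  have := hc_mul c h (P, R) (Q, S)
  simpa only [Prod.mk_mul_mk, mul_zero, zero_mul, ← hPQ, ← hRS] using this

/-- Rees congruence of an ideal. -/
def hcRees {S : Type*} [Monoid S] (I : S → Prop) (hl : ∀ x y, I y → I (x * y))
    (hr : ∀ x y, I x → I (x * y)) : Con S where
  r a b := a = b ∨ (I a ∧ I b)
  iseqv := ⟨fun _ => Or.inl rfl, by
      rintro a b (rfl | ⟨h, h'⟩)
      · exact Or.inl rfl
      · exact Or.inr ⟨h', h⟩, by
      rintro a b d (rfl | ⟨h, h'⟩) (rfl | ⟨g, g'⟩)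
      · exact Or.inl rfl
      · exact Or.inr ⟨g, g'⟩
      · exact Or.inr ⟨h, h'⟩
      · exact Or.inr ⟨h, g'⟩⟩
  mul' := by
    rintro a b d e (rfl | ⟨h, h'⟩) (rfl | ⟨g, g'⟩)
    · exact Or.inl rfl
    · exact Or.inr ⟨hl _ _ g, hl _ _ g'⟩
    · exact Or.inr ⟨hr _ _ h, hr _ _ h'⟩
    · exact Or.inr ⟨hr _ _ h, hr _ _ h'⟩

end MatrixHelpers

/-- if neither `K, K'` nor `L, L'` are H-related, the principal congruence
generated by `((K, L), (K', L'))` is the Rees congruence of the ideal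
`(I_i × I_k) ∪ (I_j × I_l)` where `i = rank K`, `j = rank K'`, `k = rank L`, `l = rank L'`. -/
theorem stmt_16 {F : Type*} [Field F] {m n : ℕ}
    (K K' : Matrix (Fin m) (Fin m) F) (L L' : Matrix (Fin n) (Fin n) F)
    (hKK : ¬ HRelM K K') (hLL : ¬ HRelM L L') :
    ∀ (M M' : Matrix (Fin m) (Fin m) F) (N N' : Matrix (Fin n) (Fin n) F),
      conGen (fun p q : Matrix (Fin m) (Fin m) F × Matrix (Fin n) (Fin n) F =>
          p = (K, L) ∧ q = (K', L')) (M, N) (M', N') ↔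
        ((M, N) = (M', N') ∨
          (((M.rank ≤ K.rank ∧ N.rank ≤ L.rank) ∨
              (M.rank ≤ K'.rank ∧ N.rank ≤ L'.rank)) ∧
           ((M'.rank ≤ K.rank ∧ N'.rank ≤ L.rank) ∨
              (M'.rank ≤ K'.rank ∧ N'.rank ≤ L'.rank)))) := by
  intro M M' N N'
  constructor
  · intro h
    let I : Matrix (Fin m) (Fin m) F × Matrix (Fin n) (Fin n) F → Prop := fun p =>
      (p.1.rank ≤ K.rank ∧ p.2.rank ≤ L.rank) ∨ (p.1.rank ≤ K'.rank ∧ p.2.rank ≤ L'.rank)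
    have hl : ∀ x y, I y → I (x * y) := by
      intro x y hy
      have h1 : (x * y).1.rank ≤ y.1.rank := Matrix.rank_mul_le_right _ _
      have h2 : (x * y).2.rank ≤ y.2.rank := Matrix.rank_mul_le_right _ _
      exact hy.imp (fun h => ⟨h1.trans h.1, h2.trans h.2⟩) (fun h => ⟨h1.trans h.1, h2.trans h.2⟩)
    have hr : ∀ x y, I x → I (x * y) := by
      intro x y hy
      have h1 : (x * y).1.rank ≤ x.1.rank := Matrix.rank_mul_le_left _ _
      have h2 : (x * y).2.rank ≤ x.2.rank := Matrix.rank_mul_le_left _ _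
      exact hy.imp (fun h => ⟨h1.trans h.1, h2.trans h.2⟩) (fun h => ⟨h1.trans h.1, h2.trans h.2⟩)
    have hle := (Con.conGen_le (c := hcRees I hl hr) (r := fun p q =>
          p = (K, L) ∧ q = (K', L'))).mpr (by
      rintro p q ⟨rfl, rfl⟩
      exact Or.inr ⟨Or.inl ⟨le_rfl, le_rfl⟩, Or.inr ⟨le_rfl, le_rfl⟩⟩)
    exact hle h
  · set c := conGen (fun p q : Matrix (Fin m) (Fin m) F × Matrix (Fin n) (Fin n) F =>
          p = (K, L) ∧ q = (K', L')) with hc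
    have h0 : c (K, L) (K', L') := ConGen.Rel.of _ _ ⟨rfl, rfl⟩
    have hz : c (K, L) (0, 0) ∧ c (K', L') (0, 0) := by
      rcases le_total K'.rank K.rank with hr | hr
      · have := hc_main c K K' L L' hKK hLL hr h0
        exact ⟨this, c.trans (c.symm h0) this⟩
      · have := hc_main c K' K L' L (fun h => hKK ⟨h.1.symm, h.2.symm⟩)
          (fun h => hLL ⟨h.1.symm, h.2.symm⟩) hr (c.symm h0)
        exact ⟨c.trans h0 this, this⟩
    have hI : ∀ X Y, ((X.rank ≤ K.rank ∧ Y.rank ≤ L.rank) ∨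
        (X.rank ≤ K'.rank ∧ Y.rank ≤ L'.rank)) → c (X, Y) (0, 0) := by
      rintro X Y (⟨h1, h2⟩ | ⟨h1, h2⟩)
      · exact hc_ideal c K X L Y hz.1 h1 h2
      · exact hc_ideal c K' X L' Y hz.2 h1 h2
    rintro (h | ⟨h1, h2⟩)
    · rw [h]; exact c.refl _
    · exact c.trans (hI _ _ h1) (c.symm (hI _ _ h2))
end

section
/- Let F be a field, K, K' ∈ F_m and L, L' ∈ F_n be such that L and L' are H-related and K, K' are not H-related. Set j = max(rank K, rank K') and k = rank L (= rank L'). Let θ be the principal congruence on F_m × F_n generated by ((K, L), (K', L')), and let θ₂ be the principal congruence on F_n generated by (L, L'). Then for all (M, N), (M', N') ∈ F_m × F_n: (M, N) θ (M', N') if and only if (M, N) = (M', N'), or [rank M ≤ j, rank M' ≤ j, rank N ≤ k, rank N' ≤ k, and N θ₂ N']. -/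
theorem aux_inj_s17 {F U W : Type*} [Field F] [AddCommGroup U] [Module F U] [AddCommGroup W]
    [Module F W] [FiniteDimensional F U] [FiniteDimensional F W]
    (h : Module.finrank F U ≤ Module.finrank F W) (u0 : U) (hu0 : u0 ≠ 0) (w0 : W)
    (hw0 : w0 ≠ 0) :
    ∃ f : U →ₗ[F] W, Function.Injective f ∧ ∃ u, u ≠ 0 ∧ f u = w0 := by
  obtain ⟨f0, hf0⟩ := finrank_le_iff_exists_linearMap.mp h
  by_cases hr : w0 ∈ LinearMap.range f0
  · obtain ⟨u, rfl⟩ := hr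
    refine ⟨f0, hf0, u, ?_, rfl⟩
    rintro rfl
    simp at hw0
  · obtain ⟨φ, hφ⟩ := Module.Projective.exists_dual_ne_zero F hu0
    refine ⟨f0 + ((φ u0)⁻¹ • φ).smulRight (w0 - f0 u0), ?_, u0, hu0, ?_⟩
    · rw [injective_iff_map_eq_zero]
      intro z hz
      simp only [LinearMap.add_apply, LinearMap.smulRight_apply, LinearMap.smul_apply,
        smul_eq_mul] at hz
      set c := (φ u0)⁻¹ * φ z with hc
      by_cases hc0 : c = 0
      · rw [hc0, zero_smul, add_zero] at hz
        exact hf0 (by simpa using hz)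
      · exfalso
        apply hr
        refine ⟨u0 - c⁻¹ • z, ?_⟩
        have : f0 z = c • (f0 u0 - w0) := by
          rw [eq_neg_of_add_eq_zero_left hz, ← smul_neg, neg_sub]
        rw [map_sub, map_smul, this, smul_smul, inv_mul_cancel₀ hc0]
        simp
    · simp [inv_mul_cancel₀ hφ]

theorem aux_factor {F V : Type*} [Field F] [AddCommGroup V] [Module F V]
    [FiniteDimensional F V] (k X : V →ₗ[F] V) (v : V) (hv : k v ≠ 0) (hX : X ≠ 0)
    (h : Module.finrank F (LinearMap.range X) ≤ Module.finrank F (LinearMap.range k)) :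
    ∃ P Q : V →ₗ[F] V, X = P ∘ₗ k ∘ₗ Q ∧ LinearMap.ker X ≤ LinearMap.ker Q ∧
      ∃ w, Q w = v ∧ X w ≠ 0 := by
  obtain ⟨x, hx⟩ : ∃ x, X x ≠ 0 := by
    by_contra! hc
    exact hX (LinearMap.ext hc)
  have hkv : k.rangeRestrict v ≠ 0 := by
    intro hc
    exact hv (congrArg Subtype.val hc)
  obtain ⟨f, hf, u, hu, hfu⟩ := aux_inj_s17 h (X.rangeRestrict x)
    (fun hc => hx (congrArg Subtype.val hc)) (k.rangeRestrict v) hkv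
  obtain ⟨s0, hs0⟩ := k.rangeRestrict.exists_rightInverse_of_surjective k.range_rangeRestrict
  obtain ⟨φ, hφ⟩ := Module.Projective.exists_dual_ne_zero F hkv
  obtain ⟨g, hg⟩ := f.exists_leftInverse_of_injective (LinearMap.ker_eq_bot.mpr hf)
  obtain ⟨p, hp⟩ := (LinearMap.range X).subtype.comp g |>.exists_extend
  have hs0' : ∀ y, k.rangeRestrict (s0 y) = y := fun y => LinearMap.congr_fun hs0 y
  have hg' : ∀ y, g (f y) = y := fun y => LinearMap.congr_fun hg y
  have hp' : ∀ y : LinearMap.range k, p y = (g y : V) := fun y => LinearMap.congr_fun hp y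
  let s := s0 + ((φ (k.rangeRestrict v))⁻¹ • φ).smulRight (v - s0 (k.rangeRestrict v))
  have hs : ∀ y, k.rangeRestrict (s y) = y := by
    intro y
    simp only [s, LinearMap.add_apply, LinearMap.smulRight_apply, map_add, map_smul, map_sub, hs0']
    simp
  have hsv : s (k.rangeRestrict v) = v := by
    simp [s, inv_mul_cancel₀ hφ]
  obtain ⟨⟨_, w, rfl⟩, hw⟩ : ∃ u' : LinearMap.range X, u' = u := ⟨u, rfl⟩
  have hw' : X.rangeRestrict w = u := hw
  refine ⟨p, s ∘ₗ f ∘ₗ X.rangeRestrict, ?_, ?_, w, ?_, ?_⟩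
  · ext y
    have h1 : k (s (f (X.rangeRestrict y))) = (f (X.rangeRestrict y) : V) :=
      congrArg Subtype.val (hs (f (X.rangeRestrict y)))
    simp only [LinearMap.comp_apply]
    rw [h1, hp', hg']
    rfl
  · intro y hy
    have : X.rangeRestrict y = 0 := Subtype.ext (by simpa using hy)
    simp only [LinearMap.mem_ker, LinearMap.comp_apply, this, map_zero]
  · simp only [LinearMap.comp_apply, hw', hfu, hsv]
  · intro hc
    apply hu
    rw [← hw']
    exact Subtype.ext hc

open Matrix in
theorem aux_drop_s17 {F : Type*} [Field F] {m : ℕ} (K K' X : Matrix (Fin m) (Fin m) F)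
    (v : Fin m → F) (hv : K *ᵥ v ≠ 0) (hv' : K' *ᵥ v = 0) (hX : X ≠ 0)
    (h : X.rank ≤ K.rank) :
    ∃ P Q : Matrix (Fin m) (Fin m) F, X = P * K * Q ∧ (P * K' * Q).rank < X.rank := by
  obtain ⟨P, Q, h1, h2, w, h3, h4⟩ := aux_factor K.mulVecLin X.mulVecLin v hv
    (fun hc => hX (by
      apply Matrix.toLin'.injective
      rw [map_zero]
      exact hc)) h
  have hXe : X = LinearMap.toMatrix' P * K * LinearMap.toMatrix' Q := by
    apply Matrix.toLin'.injective
    rw [Matrix.toLin'_mul, Matrix.toLin'_mul, Matrix.toLin'_toMatrix', Matrix.toLin'_toMatrix']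
    exact h1
  refine ⟨LinearMap.toMatrix' P, LinearMap.toMatrix' Q, hXe, ?_⟩
  set Y := LinearMap.toMatrix' P * K' * LinearMap.toMatrix' Q with hY
  have hYe : ∀ z, Y *ᵥ z = P (K' *ᵥ (Q z)) := by
    intro z
    rw [hY, ← Matrix.mulVec_mulVec, ← Matrix.mulVec_mulVec, LinearMap.toMatrix'_mulVec,
      LinearMap.toMatrix'_mulVec]
  have hlt : LinearMap.ker X.mulVecLin < LinearMap.ker Y.mulVecLin := by
    refine lt_of_le_of_ne ?_ ?_
    · intro z hz
      have : Q z = 0 := h2 hz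
      simp [hYe, this]
    · intro hc
      apply h4
      have : w ∈ LinearMap.ker Y.mulVecLin := by simp [hYe, h3, hv']
      rw [← hc] at this
      exact this
  have e1 := LinearMap.finrank_range_add_finrank_ker X.mulVecLin
  have e2 := LinearMap.finrank_range_add_finrank_ker Y.mulVecLin
  have e3 := Submodule.finrank_lt_finrank_of_lt hlt
  unfold Matrix.rank
  omega

open Matrix in
theorem aux_drop' {F : Type*} [Field F] {m : ℕ} (K K' X : Matrix (Fin m) (Fin m) F)
    (hr : K'.rank ≤ K.rank) (hK : ¬ HRelM K K') (hX : X ≠ 0)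
    (h : X.rank ≤ K.rank) :
    ∃ P Q : Matrix (Fin m) (Fin m) F, X = P * K * Q ∧ (P * K' * Q).rank < X.rank := by
  by_cases h1 : LinearMap.ker K'.mulVecLin ≤ LinearMap.ker K.mulVecLin
  · by_cases h2 : LinearMap.range K.mulVecLin ≤ LinearMap.range K'.mulVecLin
    · exfalso
      apply hK
      have e1 := LinearMap.finrank_range_add_finrank_ker K.mulVecLin
      have e2 := LinearMap.finrank_range_add_finrank_ker K'.mulVecLin
      have e3 := Submodule.finrank_mono h2
      have e4 := Submodule.finrank_mono h1
      unfold Matrix.rank at hr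
      exact ⟨Submodule.eq_of_le_of_finrank_eq h2 (by omega),
        (Submodule.eq_of_le_of_finrank_eq h1 (by omega)).symm⟩
    · obtain ⟨y, hy, hy'⟩ := SetLike.not_le_iff_exists.mp h2
      obtain ⟨x, rfl⟩ := hy
      obtain ⟨φ, hφ, hφ'⟩ := Submodule.exists_dual_map_eq_bot_of_notMem hy' inferInstance
      obtain ⟨v, rfl⟩ := (dotProductEquiv F (Fin m)).surjective φ
      have hb : ∀ z, v ⬝ᵥ (K' *ᵥ z) = 0 := by
        intro z
        have : (dotProductEquiv F (Fin m) v) (K' *ᵥ z) ∈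
            (LinearMap.range K'.mulVecLin).map (dotProductEquiv F (Fin m) v) :=
          ⟨_, ⟨z, rfl⟩, rfl⟩
        rw [hφ'] at this
        simpa using this
      have hφ2 : v ⬝ᵥ (K *ᵥ x) ≠ 0 := by simpa using hφ
      obtain ⟨P, Q, h3, h4⟩ := aux_drop_s17 Kᵀ K'ᵀ Xᵀ v
        (by
          intro hc
          rw [Matrix.mulVec_transpose] at hc
          rw [Matrix.dotProduct_mulVec, hc] at hφ2
          simp at hφ2)
        (by
          rw [Matrix.mulVec_transpose]
          apply dotProduct_eq_zero
          intro z
          rw [← Matrix.dotProduct_mulVec]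
          exact hb z)
        (by simpa using hX)
        (by simpa [Matrix.rank_transpose] using h)
      refine ⟨Qᵀ, Pᵀ, ?_, ?_⟩
      · have := congrArg Matrix.transpose h3
        simpa [Matrix.transpose_mul, Matrix.mul_assoc] using this
      · rw [← Matrix.rank_transpose X, ← Matrix.rank_transpose (_ * _)]
        simpa [Matrix.transpose_mul, Matrix.mul_assoc] using h4
  · obtain ⟨v, hv, hv'⟩ := SetLike.not_le_iff_exists.mp h1
    exact aux_drop_s17 K K' X v hv' hv hX h

open Matrix in
theorem aux_fact {F : Type*} [Field F] {m : ℕ} (K X : Matrix (Fin m) (Fin m) F)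
    (h : X.rank ≤ K.rank) : ∃ P Q : Matrix (Fin m) (Fin m) F, X = P * K * Q := by
  by_cases hX : X = 0
  · exact ⟨0, 0, by simp [hX]⟩
  have hK : K ≠ 0 := by
    rintro rfl
    rw [Matrix.rank_zero, Nat.le_zero, Matrix.rank, Submodule.finrank_eq_zero,
      LinearMap.range_eq_bot] at h
    apply hX
    apply Matrix.toLin'.injective
    rw [map_zero]
    exact h
  obtain ⟨P, Q, h1, -⟩ := aux_drop' K 0 X (by simp) (by
    intro hc
    apply hK
    apply Matrix.toLin'.injective
    rw [map_zero]
    have := hc.1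
    rw [Matrix.mulVecLin_zero, LinearMap.range_zero, LinearMap.range_eq_bot] at this
    exact this) hX h
  exact ⟨P, Q, h1⟩

open Matrix in
theorem aux_right {F : Type*} [Field F] {n : ℕ} (L L' : Matrix (Fin n) (Fin n) F)
    (h : LinearMap.range L'.mulVecLin ≤ LinearMap.range L.mulVecLin) :
    ∃ H, L' = L * H := by
  have : ∀ j, ∃ z, L *ᵥ z = L' *ᵥ (Pi.single j 1) := fun j => h ⟨Pi.single j 1, rfl⟩
  choose z hz using this
  refine ⟨(Matrix.of z)ᵀ, ?_⟩
  ext i j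
  have := congrFun (hz j) i
  rw [Matrix.mulVec_single_one] at this
  simpa [Matrix.mulVec, Matrix.mul_apply, dotProduct] using this.symm

theorem aux_zero {F : Type*} [Field F] {m n : ℕ}
    (K K' : Matrix (Fin m) (Fin m) F) (L L' : Matrix (Fin n) (Fin n) F)
    (hLH : HRelM L L') (hKK : ¬ HRelM K K') (hr : K'.rank ≤ K.rank)
    (c : Con (Matrix (Fin m) (Fin m) F × Matrix (Fin n) (Fin n) F))
    (hc : c (K, L) (K', L')) : ∀ (d : ℕ) (X : Matrix (Fin m) (Fin m) F), X.rank = d →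
      X.rank ≤ K.rank → c (X, L) (0, L) := by
  obtain ⟨H, hH⟩ := aux_right L L' hLH.1.ge
  have mulc : ∀ (P Q : Matrix (Fin m) (Fin m) F), c (P * K * Q, L) (P * K' * Q, L') := by
    intro P Q
    simpa using c.mul (c.mul (c.refl (P, 1)) hc) (c.refl (Q, 1))
  have h0 : c (0, L) (0, L') := by simpa using mulc 0 0
  intro d
  induction d using Nat.strong_induction_on with
  | _ d ih =>
    intro X hd hX
    by_cases hX0 : X = 0
    · rw [hX0]
      exact c.refl _
    obtain ⟨P, Q, h1, h2⟩ := aux_drop' K K' X hr hKK hX0 hX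
    have h3 := mulc P Q
    rw [← h1] at h3
    have h4 := ih _ (hd ▸ h2) _ rfl (h2.le.trans hX)
    have h5 := c.mul h4 (c.refl (1, H))
    simp only [Prod.mk_mul_mk, mul_one, ← hH] at h5
    exact c.trans h3 (c.trans h5 (c.symm h0))

theorem aux_back {F : Type*} [Field F] {m n : ℕ}
    (K K' : Matrix (Fin m) (Fin m) F) (L L' : Matrix (Fin n) (Fin n) F)
    (hLH : HRelM L L') (hKK : ¬ HRelM K K') (hr : K'.rank ≤ K.rank)
    (c : Con (Matrix (Fin m) (Fin m) F × Matrix (Fin n) (Fin n) F))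
    (hc : c (K, L) (K', L')) (X : Matrix (Fin m) (Fin m) F) (N : Matrix (Fin n) (Fin n) F)
    (hX : X.rank ≤ K.rank) (hN : N.rank ≤ L.rank) : c (X, N) (0, N) := by
  obtain ⟨P, Q, rfl⟩ := aux_fact L N hN
  have h := aux_zero K K' L L' hLH hKK hr c hc _ X rfl hX
  simpa using c.mul (c.mul (c.refl (1, P)) h) (c.refl (1, Q))

theorem HRelM.rank_eq' {F : Type*} [Field F] {n : ℕ} {L L' : Matrix (Fin n) (Fin n) F}
    (h : HRelM L L') : L'.rank = L.rank := by
  unfold Matrix.rank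
  rw [h.1]

/-- the congruence described by the right-hand side -/
def auxCon {F : Type*} [Field F] {m n : ℕ} (j k : ℕ) (t : Con (Matrix (Fin n) (Fin n) F)) :
    Con (Matrix (Fin m) (Fin m) F × Matrix (Fin n) (Fin n) F) where
  r p q := p = q ∨ (p.1.rank ≤ j ∧ q.1.rank ≤ j ∧ p.2.rank ≤ k ∧ q.2.rank ≤ k ∧ t p.2 q.2)
  iseqv := by
    refine ⟨fun p => Or.inl rfl, ?_, ?_⟩
    · rintro p q (h | ⟨h1, h2, h3, h4, h5⟩)
      · exact Or.inl h.symm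
      · exact Or.inr ⟨h2, h1, h4, h3, t.symm h5⟩
    · rintro p q r (rfl | ⟨h1, h2, h3, h4, h5⟩) h
      · exact h
      · rcases h with rfl | ⟨g1, g2, g3, g4, g5⟩
        · exact Or.inr ⟨h1, h2, h3, h4, h5⟩
        · exact Or.inr ⟨h1, g2, h3, g4, t.trans h5 g5⟩
  mul' := by
    rintro p q r s (rfl | ⟨h1, h2, h3, h4, h5⟩) (rfl | ⟨g1, g2, g3, g4, g5⟩)
    · exact Or.inl rfl
    · exact Or.inr ⟨(Matrix.rank_mul_le_right _ _).trans g1, (Matrix.rank_mul_le_right _ _).trans g2,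
        (Matrix.rank_mul_le_right _ _).trans g3, (Matrix.rank_mul_le_right _ _).trans g4,
        t.mul (t.refl _) g5⟩
    · exact Or.inr ⟨(Matrix.rank_mul_le_left _ _).trans h1, (Matrix.rank_mul_le_left _ _).trans h2,
        (Matrix.rank_mul_le_left _ _).trans h3, (Matrix.rank_mul_le_left _ _).trans h4,
        t.mul h5 (t.refl _)⟩
    · exact Or.inr ⟨(Matrix.rank_mul_le_left _ _).trans h1, (Matrix.rank_mul_le_left _ _).trans h2,
        (Matrix.rank_mul_le_left _ _).trans h3, (Matrix.rank_mul_le_left _ _).trans h4,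
        t.mul h5 g5⟩

/-- pairs `(N, N')` with `(0, N)` related to `(0, N')` -/
def auxCon0 {F : Type*} [Field F] {m n : ℕ}
    (c : Con (Matrix (Fin m) (Fin m) F × Matrix (Fin n) (Fin n) F)) :
    Con (Matrix (Fin n) (Fin n) F) where
  r N N' := c (0, N) (0, N')
  iseqv := ⟨fun _ => c.refl _, fun h => c.symm h, fun h h' => c.trans h h'⟩
  mul' := by
    intro a b x y h h'
    simpa using c.mul h h'

/-- description of the principal congruence on `F_m × F_n` generated by
`((K, L), (K', L'))` when `L H L'` and `K, K'` are not H-related. -/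
theorem stmt_17 {F : Type*} [Field F] {m n : ℕ}
    (K K' : Matrix (Fin m) (Fin m) F) (L L' : Matrix (Fin n) (Fin n) F)
    (hLH : HRelM L L') (hKK : ¬ HRelM K K') :
    ∀ (M M' : Matrix (Fin m) (Fin m) F) (N N' : Matrix (Fin n) (Fin n) F),
      conGen (fun p q : Matrix (Fin m) (Fin m) F × Matrix (Fin n) (Fin n) F =>
          p = (K, L) ∧ q = (K', L')) (M, N) (M', N') ↔
        ((M, N) = (M', N') ∨
          (M.rank ≤ max K.rank K'.rank ∧ M'.rank ≤ max K.rank K'.rank ∧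
            N.rank ≤ L.rank ∧ N'.rank ≤ L.rank ∧
            conGen (fun x y : Matrix (Fin n) (Fin n) F => x = L ∧ y = L') N N')) := by

  intro M M' N N'
  set c := conGen (fun p q : Matrix (Fin m) (Fin m) F × Matrix (Fin n) (Fin n) F =>
          p = (K, L) ∧ q = (K', L')) with hcdef
  set t := conGen (fun x y : Matrix (Fin n) (Fin n) F => x = L ∧ y = L') with htdef
  have hc : c (K, L) (K', L') := Con.le_conGen _ _ ⟨rfl, rfl⟩
  have ht : t L L' := Con.le_conGen _ _ ⟨rfl, rfl⟩
  constructor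
  · intro h
    have hle : c ≤ auxCon (max K.rank K'.rank) L.rank t := by
      rw [hcdef, Con.conGen_le]
      rintro p q ⟨rfl, rfl⟩
      exact Or.inr ⟨le_max_left _ _, le_max_right _ _, le_rfl, hLH.rank_eq'.le, ht⟩
    exact hle h
  · rintro (h | ⟨h1, h2, h3, h4, h5⟩)
    · rw [h]
      exact c.refl _
    · have key : ∀ (X : Matrix (Fin m) (Fin m) F) (Y : Matrix (Fin n) (Fin n) F),
          X.rank ≤ max K.rank K'.rank → Y.rank ≤ L.rank → c (X, Y) (0, Y) := by
        intro X Y hX hY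
        rcases le_total K'.rank K.rank with hr | hr
        · exact aux_back K K' L L' hLH hKK hr c hc X Y (by rwa [max_eq_left hr] at hX) hY
        · exact aux_back K' K L' L ⟨hLH.1.symm, hLH.2.symm⟩
            (fun hh => hKK ⟨hh.1.symm, hh.2.symm⟩) hr c (c.symm hc) X Y
            (by rwa [max_eq_right hr] at hX) (by rwa [hLH.rank_eq'])
      have hle : t ≤ auxCon0 c := by
        rw [htdef, Con.conGen_le]
        rintro p q ⟨rfl, rfl⟩
        have : c (0, p) (0, q) := by simpa using c.mul (c.refl (0, 1)) hc
        exact this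
      have h6 : c (0, N) (0, N') := hle h5
      exact c.trans (key _ _ h1 h3) (c.trans h6 (c.symm (key _ _ h2 h4)))
end
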